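/- Let n ≥ 2, s ∈ (0,1) and σ ∈ (−1,1). For θ ∈ (0,π) set H = {x ∈ ℝⁿ : x_n > 0}, J_θ = {x ∈ ℝⁿ : x_n > 0 and (cos α) x_n = (sin α) x_1 for some α ∈ (0,θ)}, and e(θ) = (cos θ) e₁ + (sin θ) e_n. Then there exists a unique θ = θ(s,σ) ∈ (0,π) such that lim_{ρ→0⁺} ∫_{{z : |z−e(θ)|>ρ}} (1_{H∖J_θ}(z) + σ 1_{ℝⁿ∖H}(z) − 1_{J_θ}(z)) |e(θ)−z|^{−(n+s)} dz = 0. Moreover, the map σ ↦ θ(s,σ) is strictly increasing on (−1,1), θ(s,0) = π/2, θ(s,σ) → 0 as σ → (−1)⁺, and θ(s,σ) → π as σ → 1⁻. -/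

import Mathlib

open MeasureTheory Filter Metric
open scoped ENNReal NNReal Topology

/-- The upper half space `H = {x ∈ ℝⁿ : x_n > 0}`. -/
def Hset (n : ℕ) (hn : 2 ≤ n) : Set (EuclideanSpace ℝ (Fin n)) :=
  {x | 0 < x ⟨n - 1, by omega⟩}

/-- The cone `J_θ = {x : x_n > 0 and cos α · x_n = sin α · x_1 for some α ∈ (0,θ)}`. -/
def Jset (n : ℕ) (hn : 2 ≤ n) (θ : ℝ) : Set (EuclideanSpace ℝ (Fin n)) :=
  {x | 0 < x ⟨n - 1, by omega⟩ ∧ ∃ α ∈ Set.Ioo 0 θ,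
    Real.cos α * x ⟨n - 1, by omega⟩ = Real.sin α * x ⟨0, by omega⟩}

/-- The point `e(θ) = cos θ e₁ + sin θ e_n`. -/
noncomputable def ePt (n : ℕ) (hn : 2 ≤ n) (θ : ℝ) : EuclideanSpace ℝ (Fin n) :=
  Real.cos θ • EuclideanSpace.single ⟨0, by omega⟩ (1 : ℝ)
    + Real.sin θ • EuclideanSpace.single ⟨n - 1, by omega⟩ (1 : ℝ)

/-- The nonlocal Young's law equation for the angle `θ`: the principal value of
`∫ (1_{H∖J_θ} + σ 1_{Hᶜ} − 1_{J_θ})(z) |e(θ)−z|^{-(n+s)} dz` vanishes. -/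
def YoungPV (n : ℕ) (hn : 2 ≤ n) (s σ θ : ℝ) : Prop :=
  Tendsto (fun ρ : ℝ => ∫ z in {z | ρ < dist z (ePt n hn θ)},
      (Set.indicator (Hset n hn \ Jset n hn θ) (fun _ => (1 : ℝ)) z
        + σ * Set.indicator (Hset n hn)ᶜ (fun _ => (1 : ℝ)) z
        - Set.indicator (Jset n hn θ) (fun _ => (1 : ℝ)) z)
      * ‖ePt n hn θ - z‖ ^ (-((n : ℝ) + s)))
    (𝓝[>] (0 : ℝ)) (nhds 0)

namespace YoungLaw

section Kernel

variable {E : Type*} [NormedAddCommGroup E] [NormedSpace ℝ E] [FiniteDimensional ℝ E]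
  [MeasurableSpace E] [BorelSpace E] {μ : Measure E} [μ.IsAddHaarMeasure]

lemma integrableOn_norm_sub_rpow {r ρ : ℝ} (hr : (Module.finrank ℝ E : ℝ) < r) (hρ : 0 < ρ)
    (p : E) : IntegrableOn (fun z => ‖p - z‖ ^ (-r)) {z | ρ ≤ dist z p} μ := by
  have hr0 : 0 ≤ r := (Nat.cast_nonneg _).trans hr.le
  set C : ℝ := ((1 + ρ) / ρ) ^ r
  have hI : Integrable (fun z : E => C * (1 + ‖p - z‖) ^ (-r)) μ :=
    ((integrable_one_add_norm hr).comp_sub_left p).const_mul C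
  refine hI.integrableOn.mono' (Measurable.aestronglyMeasurable (by fun_prop)) ?_
  refine (ae_restrict_iff' (measurableSet_le (by fun_prop) (by fun_prop))).2 (.of_forall ?_)
  intro z hz
  have hz' : ρ ≤ ‖p - z‖ := by simpa [dist_eq_norm, norm_sub_rev] using hz
  have hpos : 0 < ‖p - z‖ := hρ.trans_le hz'
  rw [Real.norm_of_nonneg (by positivity), Real.rpow_neg hpos.le, Real.rpow_neg (by positivity),
    ← Real.inv_rpow hpos.le, ← Real.inv_rpow (by positivity),
    ← Real.mul_rpow (by positivity) (by positivity)]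
  refine Real.rpow_le_rpow (by positivity) ?_ hr0
  rw [← div_eq_mul_inv, div_div, le_div_iff₀ (by positivity), inv_mul_le_iff₀ hpos]
  nlinarith

end Kernel

section Plane

variable {ι : Type*} {i j : ι}

/-- The points whose angle with the `i`-th axis, seen in the plane of `i` and `j`, has cotangent
at most `c`. -/
def cone (i j : ι) (c : ℝ) : Set (EuclideanSpace ℝ ι) := {z | z i ≤ c * |z j|}

lemma measurableSet_cone (c : ℝ) : MeasurableSet (cone i j c) :=
  measurableSet_le (by fun_prop) (by fun_prop)

lemma cone_mono {a b : ℝ} (h : a ≤ b) : cone i j a ⊆ cone i j b := fun _ hz =>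
  le_trans hz (mul_le_mul_of_nonneg_right h (abs_nonneg _))

variable [DecidableEq ι]

/-- The unit vector at angle `θ` in the plane of the `i`-th and `j`-th coordinates. -/
noncomputable def dir (i j : ι) (θ : ℝ) : EuclideanSpace ℝ ι :=
  Real.cos θ • EuclideanSpace.single i (1 : ℝ) + Real.sin θ • EuclideanSpace.single j (1 : ℝ)

lemma dir_apply_left (hij : i ≠ j) (θ : ℝ) : dir i j θ i = Real.cos θ := by
  simp [dir, hij]

lemma dir_apply_right (hij : i ≠ j) (θ : ℝ) : dir i j θ j = Real.sin θ := by
  simp [dir, hij.symm]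

variable [Fintype ι]

lemma inner_dir (θ : ℝ) (x : EuclideanSpace ℝ ι) :
    inner ℝ (dir i j θ) x = Real.cos θ * x i + Real.sin θ * x j := by
  simp [dir, inner_add_left, inner_smul_left, EuclideanSpace.inner_single_left]

lemma norm_dir (hij : i ≠ j) (θ : ℝ) : ‖dir i j θ‖ = 1 := by
  have h : inner ℝ (dir i j θ) (dir i j θ) = (1 : ℝ) := by
    rw [inner_dir, dir_apply_left hij, dir_apply_right hij]
    nlinarith [Real.sin_sq_add_cos_sq θ]
  rw [real_inner_self_eq_norm_sq] at h
  nlinarith [norm_nonneg (dir i j θ)]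

/-- The reflection across the line at angle `θ / 2` in the coordinate plane of `i` and `j`. It
sends the angle `φ` in that plane to `θ - φ`, and is `-1` on the orthogonal complement. -/
noncomputable def planeRefl (i j : ι) (θ : ℝ) : EuclideanSpace ℝ ι ≃ₗᵢ[ℝ] EuclideanSpace ℝ ι :=
  (Submodule.span ℝ {dir i j (θ / 2)}).reflection

lemma planeRefl_eq (hij : i ≠ j) (θ : ℝ) (x : EuclideanSpace ℝ ι) :
    planeRefl i j θ x =
      (2 * (Real.cos (θ / 2) * x i + Real.sin (θ / 2) * x j)) • dir i j (θ / 2) - x := by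
  have h := Submodule.reflection_singleton_apply (𝕜 := ℝ) (dir i j (θ / 2)) x
  rw [planeRefl, h, norm_dir hij, inner_dir, mul_smul, two_smul, two_smul]
  simp

lemma cos_eq_half (θ : ℝ) : Real.cos θ = 2 * Real.cos (θ / 2) ^ 2 - 1 := by
  rw [← Real.cos_two_mul]; ring_nf

lemma sin_eq_half (θ : ℝ) : Real.sin θ = 2 * Real.sin (θ / 2) * Real.cos (θ / 2) := by
  rw [← Real.sin_two_mul]; ring_nf

lemma planeRefl_apply_left (hij : i ≠ j) (θ : ℝ) (x : EuclideanSpace ℝ ι) :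
    planeRefl i j θ x i = Real.cos θ * x i + Real.sin θ * x j := by
  rw [planeRefl_eq hij, PiLp.sub_apply, PiLp.smul_apply, dir_apply_left hij, cos_eq_half θ,
    sin_eq_half θ, smul_eq_mul]
  ring

lemma planeRefl_apply_right (hij : i ≠ j) (θ : ℝ) (x : EuclideanSpace ℝ ι) :
    planeRefl i j θ x j = Real.sin θ * x i - Real.cos θ * x j := by
  rw [planeRefl_eq hij, PiLp.sub_apply, PiLp.smul_apply, dir_apply_right hij, cos_eq_half θ,
    sin_eq_half θ, smul_eq_mul]
  linear_combination 2 * x j * Real.sin_sq_add_cos_sq (θ / 2)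

lemma planeRefl_dir_zero (hij : i ≠ j) (θ : ℝ) : planeRefl i j θ (dir i j 0) = dir i j θ := by
  rw [planeRefl_eq hij, dir_apply_left hij, dir_apply_right hij]
  simp only [dir, Real.cos_zero, Real.sin_zero, cos_eq_half θ, sin_eq_half θ]
  module

lemma dist_planeRefl (hij : i ≠ j) (θ : ℝ) (z : EuclideanSpace ℝ ι) :
    dist (planeRefl i j θ z) (dir i j θ) = dist z (dir i j 0) := by
  rw [← planeRefl_dir_zero hij θ, LinearIsometryEquiv.dist_map]

/-- Integrals over the complement of a ball can be moved from `dir i j θ` to `dir i j 0`. -/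
lemma setIntegral_planeRefl (hij : i ≠ j) (θ ρ q : ℝ) (w : EuclideanSpace ℝ ι → ℝ) :
    ∫ z in {z | ρ < dist z (dir i j θ)}, w z * ‖dir i j θ - z‖ ^ q =
      ∫ z in {z | ρ < dist z (dir i j 0)}, w (planeRefl i j θ z) * ‖dir i j 0 - z‖ ^ q := by
  rw [← (planeRefl i j θ).measurePreserving.setIntegral_preimage_emb
    (planeRefl i j θ).toHomeomorph.measurableEmbedding]
  simp only [Set.preimage_ofPred_eq, dist_planeRefl hij]
  congr! 4 with z
  rw [← dist_eq_norm, ← dist_eq_norm, dist_comm, dist_planeRefl hij, dist_comm]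

lemma volume_linear_eq_zero (hij : i ≠ j) (c : ℝ) :
    volume {z : EuclideanSpace ℝ ι | z i = c * z j} = 0 := by
  have h := Measure.addHaar_submodule (volume : Measure (EuclideanSpace ℝ ι))
    (LinearMap.ker ((EuclideanSpace.proj i - c • EuclideanSpace.proj j :
      EuclideanSpace ℝ ι →L[ℝ] ℝ) : EuclideanSpace ℝ ι →ₗ[ℝ] ℝ)) ?_
  · convert h using 2
    ext z
    simp [sub_eq_zero]
  · intro htop
    have : dir i j 0 ∈ LinearMap.ker ((EuclideanSpace.proj i - c • EuclideanSpace.proj j :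
      EuclideanSpace ℝ ι →L[ℝ] ℝ) : EuclideanSpace ℝ ι →ₗ[ℝ] ℝ) := by rw [htop]; trivial
    simp [dir_apply_left hij, dir_apply_right hij] at this

lemma ae_apply_ne_zero (hij : i ≠ j) :
    ∀ᵐ z : EuclideanSpace ℝ ι, z j ≠ 0 := by
  have h := volume_linear_eq_zero hij.symm 0
  simpa [ae_iff] using h

lemma ae_apply_ne_mul_abs (hij : i ≠ j) (c : ℝ) :
    ∀ᵐ z : EuclideanSpace ℝ ι, z i ≠ c * |z j| := by
  have h1 := measure_eq_zero_iff_ae_notMem.1 (volume_linear_eq_zero hij c)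
  have h2 := measure_eq_zero_iff_ae_notMem.1 (volume_linear_eq_zero hij (-c))
  filter_upwards [h1, h2] with z hz1 hz2 h
  rcases abs_cases (z j) with ⟨ha, -⟩ | ⟨ha, -⟩ <;> rw [ha] at h
  · exact hz1 h
  · exact hz2 (by simpa using h)

/-- The mass of a cone for the kernel `|z - e|⁻ʳ` with singularity at `e = dir i j 0`. -/
noncomputable def coneMass (i j : ι) (r c : ℝ) : ℝ := ∫ z in cone i j c, ‖dir i j 0 - z‖ ^ (-r)

lemma inv_le_dist_of_mem_cone (hij : i ≠ j) {c : ℝ} {z : EuclideanSpace ℝ ι}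
    (hz : z ∈ cone i j c) : (1 + |c|)⁻¹ ≤ dist z (dir i j 0) := by
  have h1 : |z i - 1| ≤ dist z (dir i j 0) := by
    simpa [dist_eq_norm, dir_apply_left hij] using PiLp.norm_apply_le (z - dir i j 0) i
  have h2 : |z j| ≤ dist z (dir i j 0) := by
    simpa [dist_eq_norm, dir_apply_right hij] using PiLp.norm_apply_le (z - dir i j 0) j
  have hz' : z i ≤ c * |z j| := hz
  have h3 : c * |z j| ≤ |c| * dist z (dir i j 0) :=
    mul_le_mul (le_abs_self c) h2 (abs_nonneg _) (abs_nonneg _)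
  rw [inv_le_iff_one_le_mul₀ (by positivity)]
  linarith [(abs_le.1 h1).1]

variable {r : ℝ}

lemma integrableOn_cone (hij : i ≠ j) (hr : (Fintype.card ι : ℝ) < r) (c : ℝ) :
    IntegrableOn (fun z => ‖dir i j 0 - z‖ ^ (-r)) (cone i j c) := by
  refine (integrableOn_norm_sub_rpow (by simpa using hr) (ρ := (1 + |c|)⁻¹) (by positivity)
    (dir i j 0)).mono_set ?_
  exact fun z hz => inv_le_dist_of_mem_cone hij hz

lemma strictMono_coneMass (hij : i ≠ j) (hr : (Fintype.card ι : ℝ) < r) :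
    StrictMono (coneMass i j r) := by
  intro a b hab
  have hdiff := setIntegral_sdiff (measurableSet_cone (i := i) (j := j) a)
    (integrableOn_cone hij hr b) (cone_mono hab.le)
  have hpos : 0 < ∫ z in cone i j b \ cone i j a, ‖dir i j 0 - z‖ ^ (-r) := by
    rw [setIntegral_pos_iff_support_of_nonneg_ae (.of_forall fun z => by positivity)
      ((integrableOn_cone hij hr b).mono_set Set.sdiff_subset)]
    have hopen : IsOpen {z : EuclideanSpace ℝ ι | a * |z j| < z i ∧ z i < b * |z j|} :=
      IsOpen.and (isOpen_lt (by fun_prop) (by fun_prop)) (isOpen_lt (by fun_prop) (by fun_prop))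
    refine (hopen.measure_pos volume ⟨((a + b) / 2) • EuclideanSpace.single i (1 : ℝ) +
      EuclideanSpace.single j (1 : ℝ), ?_⟩).trans_le (measure_mono ?_)
    · simp only [Set.mem_ofPred_eq, PiLp.add_apply, PiLp.smul_apply]
      simp only [PiLp.single_apply, hij, hij.symm]
      constructor <;> simp <;> linarith
    · rintro z ⟨hz1, hz2⟩
      have hzb : z ∈ cone i j b := hz2.le
      refine ⟨?_, hzb, not_le.2 hz1⟩
      have hd : 0 < dist z (dir i j 0) :=
        lt_of_lt_of_le (by positivity) (inv_le_dist_of_mem_cone hij hzb)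
      rw [dist_comm, dist_eq_norm] at hd
      exact (Real.rpow_pos_of_pos hd _).ne'
  rw [hdiff] at hpos
  exact sub_pos.1 hpos

lemma coneMass_eq_integral_indicator (r c : ℝ) :
    coneMass i j r c = ∫ z, (cone i j c).indicator (fun z => ‖dir i j 0 - z‖ ^ (-r)) z :=
  (integral_indicator (measurableSet_cone c)).symm

lemma aestronglyMeasurable_cone_indicator (r c : ℝ) : AEStronglyMeasurable
    ((cone i j c).indicator fun z : EuclideanSpace ℝ ι => ‖dir i j 0 - z‖ ^ (-r)) :=
  (Measurable.indicator (by fun_prop) (measurableSet_cone c)).aestronglyMeasurable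

lemma norm_cone_indicator_le {a b : ℝ} (h : a ≤ b) (z : EuclideanSpace ℝ ι) :
    ‖(cone i j a).indicator (fun z => ‖dir i j 0 - z‖ ^ (-r)) z‖ ≤
      (cone i j b).indicator (fun z => ‖dir i j 0 - z‖ ^ (-r)) z := by
  rw [Real.norm_of_nonneg (Set.indicator_nonneg (fun _ _ => by positivity) _)]
  exact Set.indicator_le_indicator_of_subset (cone_mono h) (fun _ => by positivity) _

lemma continuous_coneMass (hij : i ≠ j) (hr : (Fintype.card ι : ℝ) < r) :
    Continuous (coneMass i j r) := by
  refine continuous_iff_continuousAt.2 fun c => ?_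
  simp only [funext (coneMass_eq_integral_indicator (i := i) (j := j) r)]
  refine continuousAt_of_dominated
    (bound := (cone i j (c + 1)).indicator fun z => ‖dir i j 0 - z‖ ^ (-r))
    (.of_forall fun a => aestronglyMeasurable_cone_indicator r a) ?_
    ((integrableOn_cone hij hr (c + 1)).integrable_indicator (measurableSet_cone _)) ?_
  · filter_upwards [eventually_le_nhds (lt_add_one c)] with a ha
    exact .of_forall fun z => norm_cone_indicator_le ha z
  · filter_upwards [ae_apply_ne_mul_abs hij c] with z hz
    have hcont : Continuous fun a : ℝ => a * |z j| := by fun_prop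
    rcases lt_or_gt_of_ne hz with h | h
    · refine continuousAt_const.congr (f := fun _ => ‖dir i j 0 - z‖ ^ (-r)) ?_
      filter_upwards [hcont.continuousAt.eventually (lt_mem_nhds h)] with a ha
      rw [Set.indicator_of_mem (show z ∈ cone i j a from le_of_lt ha)]
    · refine continuousAt_const.congr (f := fun _ => (0 : ℝ)) ?_
      filter_upwards [hcont.continuousAt.eventually (gt_mem_nhds h)] with a ha
      rw [Set.indicator_of_notMem (show z ∉ cone i j a from not_le.2 ha)]

lemma tendsto_coneMass_atBot (hij : i ≠ j) (hr : (Fintype.card ι : ℝ) < r) :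
    Tendsto (coneMass i j r) atBot (𝓝 0) := by
  simp only [funext (coneMass_eq_integral_indicator (i := i) (j := j) r)]
  refine (tendsto_integral_filter_of_dominated_convergence (f := fun _ => (0 : ℝ))
    ((cone i j 0).indicator fun z => ‖dir i j 0 - z‖ ^ (-r))
    (.of_forall fun a => aestronglyMeasurable_cone_indicator r a) ?_
    ((integrableOn_cone hij hr 0).integrable_indicator (measurableSet_cone _)) ?_).trans_eq
    (by simp)
  · filter_upwards [eventually_le_atBot 0] with a ha
    exact .of_forall fun z => norm_cone_indicator_le ha z
  · filter_upwards [ae_apply_ne_zero hij] with z hz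
    have hlim : Tendsto (fun a : ℝ => a * |z j|) atBot atBot :=
      tendsto_id.atBot_mul_const (abs_pos.2 hz)
    refine tendsto_const_nhds.congr' (f₁ := fun _ => (0 : ℝ)) ?_
    filter_upwards [hlim.eventually_lt_atBot (z i)] with a ha
    rw [Set.indicator_of_notMem (show z ∉ cone i j a from not_le.2 ha)]

end Plane

section Weight

/-- The weight of Young's law in the coordinates in which the ray through the singular point is
the positive first axis; `c` is the cotangent of the contact angle. -/
noncomputable def planeWeight (σ c x y : ℝ) : ℝ :=
  if c * y < x then (if 0 < y then -1 else 1) else σ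

lemma abs_planeWeight_le (σ c x y : ℝ) : |planeWeight σ c x y| ≤ 1 + |σ| := by
  unfold planeWeight
  split_ifs <;> simp

lemma measurable_planeWeight (σ c : ℝ) : Measurable fun p : ℝ × ℝ => planeWeight σ c p.1 p.2 :=
  Measurable.ite (measurableSet_lt (by fun_prop) (by fun_prop))
    (Measurable.ite (measurableSet_lt (by fun_prop) (by fun_prop)) measurable_const
      measurable_const) measurable_const

lemma planeWeight_add_reflect (σ c x : ℝ) {y : ℝ} (hy : y ≠ 0) :
    planeWeight σ c x y + planeWeight σ c x (-y) =
      (if x ≤ c * |y| then 1 + σ else 0) - (if x ≤ -c * |y| then 1 - σ else 0) := by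
  unfold planeWeight
  rcases lt_or_gt_of_ne hy with h | h
  · simp only [abs_of_neg h, Left.neg_pos_iff, h, h.not_gt, ← not_lt, mul_neg]
    split_ifs <;> first | ring1 | (exfalso; first | assumption | linarith)
  · simp only [abs_of_pos h, Left.neg_pos_iff, h, h.not_gt, ← not_lt, neg_mul, mul_neg]
    split_ifs <;> first | ring1 | contradiction

variable {ι : Type*} [Fintype ι] [DecidableEq ι] {i j : ι} {r : ℝ}

lemma integrableOn_planeWeight_mul (hr : (Fintype.card ι : ℝ) < r) (σ c : ℝ) {ρ : ℝ}
    (hρ : 0 < ρ) : IntegrableOn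
      (fun z => planeWeight σ c (z i) (z j) * ‖dir i j 0 - z‖ ^ (-r))
      {z | ρ < dist z (dir i j 0)} := by
  have hk : IntegrableOn (fun z => ‖dir i j 0 - z‖ ^ (-r)) {z | ρ < dist z (dir i j 0)} :=
    (integrableOn_norm_sub_rpow (by simpa using hr) hρ (dir i j 0)).mono_set
      fun z (hz : ρ < dist z _) => hz.le
  refine hk.bdd_mul (c := 1 + |σ|) ?_ (.of_forall fun z => abs_planeWeight_le _ _ _ _)
  exact ((measurable_planeWeight σ c).comp (f := fun z : EuclideanSpace ℝ ι => (z i, z j))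
    (by fun_prop)).aestronglyMeasurable

lemma setIntegral_planeWeight (hij : i ≠ j) (hr : (Fintype.card ι : ℝ) < r) (σ c : ℝ) {ρ : ℝ}
    (hρ : 0 < ρ) (hρc : ρ < (1 + |c|)⁻¹) :
    ∫ z in {z | ρ < dist z (dir i j 0)},
        planeWeight σ c (z i) (z j) * ‖dir i j 0 - z‖ ^ (-r) =
      ((1 + σ) * coneMass i j r c - (1 - σ) * coneMass i j r (-c)) / 2 := by
  set B : Set (EuclideanSpace ℝ ι) := {z | ρ < dist z (dir i j 0)}
  have hsub : cone i j c ⊆ B := fun z hz => hρc.trans_le (inv_le_dist_of_mem_cone hij hz)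
  have hsub' : cone i j (-c) ⊆ B := fun z hz =>
    hρc.trans_le (abs_neg c ▸ inv_le_dist_of_mem_cone hij hz)
  have hB : MeasurableSet B := measurableSet_lt (by fun_prop) (by fun_prop)
  have hrefl := setIntegral_planeRefl hij 0 ρ (-r) fun z => planeWeight σ c (z i) (z j)
  simp only [planeRefl_apply_left hij, planeRefl_apply_right hij, Real.cos_zero, Real.sin_zero,
    one_mul, zero_mul, add_zero, zero_sub] at hrefl
  have hint := integrableOn_planeWeight_mul (i := i) (j := j) hr σ c hρ
  have hint' : IntegrableOn
      (fun z => planeWeight σ c (z i) (-z j) * ‖dir i j 0 - z‖ ^ (-r)) B := by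
    have h := ((planeRefl i j 0).measurePreserving.integrableOn_comp_preimage
      (planeRefl i j 0).toHomeomorph.measurableEmbedding).2 hint
    have hpre : planeRefl i j 0 ⁻¹' B = B := by
      ext z
      simp only [B, Set.mem_preimage, Set.mem_ofPred_eq, dist_planeRefl hij]
    rw [hpre] at h
    refine h.congr (.of_forall fun z => ?_)
    simp only [Function.comp_apply, planeRefl_apply_left hij, planeRefl_apply_right hij,
      Real.cos_zero, Real.sin_zero, one_mul, zero_mul, add_zero, zero_sub]
    rw [← dist_eq_norm, ← dist_eq_norm, dist_comm, dist_planeRefl hij, dist_comm]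
  have hk : ∀ a, IntegrableOn
      ((cone i j a).indicator fun z => ‖dir i j 0 - z‖ ^ (-r)) B := fun a =>
    ((integrableOn_cone hij hr a).integrable_indicator (measurableSet_cone a)).integrableOn
  have hsum : ∫ z in B, (planeWeight σ c (z i) (z j) * ‖dir i j 0 - z‖ ^ (-r) +
      planeWeight σ c (z i) (-z j) * ‖dir i j 0 - z‖ ^ (-r)) =
      ∫ z in B, ((1 + σ) * (cone i j c).indicator (fun z => ‖dir i j 0 - z‖ ^ (-r)) z -
        (1 - σ) * (cone i j (-c)).indicator (fun z => ‖dir i j 0 - z‖ ^ (-r)) z) := by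
    refine integral_congr_ae (ae_restrict_of_ae ?_)
    filter_upwards [ae_apply_ne_zero hij] with z hz
    rw [← add_mul, planeWeight_add_reflect σ c (z i) hz]
    simp only [Set.indicator_apply, cone, Set.mem_ofPred_eq]
    split_ifs <;> ring
  rw [integral_add hint hint', ← hrefl, integral_sub ((hk c).const_mul _) ((hk (-c)).const_mul _),
    integral_const_mul, integral_const_mul, setIntegral_indicator (measurableSet_cone c),
    setIntegral_indicator (measurableSet_cone (-c)), Set.inter_eq_right.2 hsub,
    Set.inter_eq_right.2 hsub'] at hsum
  rw [coneMass, coneMass]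
  linarith

end Weight

section Young

lemma cot_mul_lt_iff {θ x y : ℝ} (hθ : θ ∈ Set.Ioo 0 Real.pi) :
    Real.tan (Real.pi / 2 - θ) * y < x ↔ 0 < Real.sin θ * x - Real.cos θ * y := by
  have hs := Real.sin_pos_of_mem_Ioo hθ
  rw [Real.tan_eq_sin_div_cos, Real.sin_pi_div_two_sub, Real.cos_pi_div_two_sub,
    div_mul_eq_mul_div, div_lt_iff₀ hs, sub_pos, mul_comm x]

/-- A cone of angles in `(0, θ)` is an intersection of half planes. -/
lemma exists_angle_iff {θ x y : ℝ} (hθ : θ ∈ Set.Ioo 0 Real.pi) (hy : 0 < y) :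
    (∃ α ∈ Set.Ioo 0 θ, Real.cos α * y = Real.sin α * x) ↔
      0 < Real.sin θ * x - Real.cos θ * y := by
  constructor
  · rintro ⟨α, hα, h⟩
    have hs := Real.sin_pos_of_pos_of_lt_pi hα.1 (hα.2.trans hθ.2)
    have hd := Real.sin_pos_of_pos_of_lt_pi (sub_pos.2 hα.2) (by linarith [hα.1, hθ.2])
    rw [Real.sin_sub] at hd
    refine pos_of_mul_pos_right (a := Real.sin α) ?_ hs.le
    have := mul_pos hy hd
    linear_combination this + Real.sin θ * h
  · intro h
    set t := Real.arctan (x / y)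
    have ht : Real.sin t * y = Real.cos t * x := by
      have hc := Real.cos_arctan_pos (x / y)
      have := Real.tan_arctan (x / y)
      rw [Real.tan_eq_sin_div_cos, div_eq_div_iff hc.ne' hy.ne'] at this
      linarith
    have ht1 := Real.neg_pi_div_two_lt_arctan (x / y)
    have ht2 := Real.arctan_lt_pi_div_two (x / y)
    refine ⟨Real.pi / 2 - t, ⟨by linarith, ?_⟩, ?_⟩
    · by_contra! hle
      have hcos : 0 ≤ Real.cos (θ + t) :=
        Real.cos_nonneg_of_neg_pi_div_two_le_of_le (by linarith [hθ.1]) (by linarith)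
      have hlt := mul_pos (Real.cos_arctan_pos (x / y)) h
      have heq : Real.cos t * (Real.sin θ * x - Real.cos θ * y) = -(y * Real.cos (θ + t)) := by
        rw [Real.cos_add]
        linear_combination -Real.sin θ * ht
      have hge := mul_nonneg hy.le hcos
      linarith
    · rw [Real.cos_pi_div_two_sub, Real.sin_pi_div_two_sub, ht]

variable {n : ℕ} (hn : 2 ≤ n) {θ : ℝ}

lemma weight_planeRefl (hθ : θ ∈ Set.Ioo 0 Real.pi) (σ : ℝ) (z : EuclideanSpace ℝ (Fin n)) :
    (Set.indicator (Hset n hn \ Jset n hn θ) (fun _ => (1 : ℝ))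
          (planeRefl ⟨0, by omega⟩ ⟨n - 1, by omega⟩ θ z)
        + σ * Set.indicator (Hset n hn)ᶜ (fun _ => (1 : ℝ))
          (planeRefl ⟨0, by omega⟩ ⟨n - 1, by omega⟩ θ z)
        - Set.indicator (Jset n hn θ) (fun _ => (1 : ℝ))
          (planeRefl ⟨0, by omega⟩ ⟨n - 1, by omega⟩ θ z)) =
      planeWeight σ (Real.tan (Real.pi / 2 - θ)) (z ⟨0, by omega⟩) (z ⟨n - 1, by omega⟩) := by
  have hij : (⟨0, by omega⟩ : Fin n) ≠ ⟨n - 1, by omega⟩ := by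
    simp only [ne_eq, Fin.mk.injEq]; omega
  set R := planeRefl (⟨0, by omega⟩ : Fin n) ⟨n - 1, by omega⟩ θ
  have hH : R z ∈ Hset n hn ↔
      Real.tan (Real.pi / 2 - θ) * z ⟨n - 1, by omega⟩ < z ⟨0, by omega⟩ := by
    rw [cot_mul_lt_iff hθ, ← planeRefl_apply_right hij]
    rfl
  have hJ : R z ∈ Jset n hn θ ↔ R z ∈ Hset n hn ∧ 0 < z ⟨n - 1, by omega⟩ := by
    refine and_congr_right fun hy => ?_
    rw [exists_angle_iff hθ hy, planeRefl_apply_right hij, planeRefl_apply_left hij]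
    have : Real.sin θ * (Real.cos θ * z ⟨0, by omega⟩ + Real.sin θ * z ⟨n - 1, by omega⟩) -
        Real.cos θ * (Real.sin θ * z ⟨0, by omega⟩ - Real.cos θ * z ⟨n - 1, by omega⟩) =
        z ⟨n - 1, by omega⟩ := by
      linear_combination z ⟨n - 1, by omega⟩ * Real.sin_sq_add_cos_sq θ
    rw [this]
  unfold planeWeight Set.indicator
  split_ifs <;> simp_all

lemma youngPV_iff (hθ : θ ∈ Set.Ioo 0 Real.pi) {s : ℝ} (hs : 0 < s) (σ : ℝ) :
    YoungPV n hn s σ θ ↔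
      (1 + σ) * coneMass (⟨0, by omega⟩ : Fin n) ⟨n - 1, by omega⟩ (n + s)
          (Real.tan (Real.pi / 2 - θ)) -
        (1 - σ) * coneMass (⟨0, by omega⟩ : Fin n) ⟨n - 1, by omega⟩ (n + s)
          (-Real.tan (Real.pi / 2 - θ)) = 0 := by
  have hij : (⟨0, by omega⟩ : Fin n) ≠ ⟨n - 1, by omega⟩ := by
    simp only [ne_eq, Fin.mk.injEq]; omega
  have hr : (Fintype.card (Fin n) : ℝ) < n + s := by simpa using hs
  have hev : (fun ρ : ℝ => ∫ z in {z | ρ < dist z (ePt n hn θ)},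
      (Set.indicator (Hset n hn \ Jset n hn θ) (fun _ => (1 : ℝ)) z
        + σ * Set.indicator (Hset n hn)ᶜ (fun _ => (1 : ℝ)) z
        - Set.indicator (Jset n hn θ) (fun _ => (1 : ℝ)) z)
      * ‖ePt n hn θ - z‖ ^ (-((n : ℝ) + s))) =ᶠ[𝓝[>] 0] fun _ =>
      ((1 + σ) * coneMass (⟨0, by omega⟩ : Fin n) ⟨n - 1, by omega⟩ (n + s)
          (Real.tan (Real.pi / 2 - θ)) -
        (1 - σ) * coneMass (⟨0, by omega⟩ : Fin n) ⟨n - 1, by omega⟩ (n + s)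
          (-Real.tan (Real.pi / 2 - θ))) / 2 := by
    have hpos : (0 : ℝ) < (1 + |Real.tan (Real.pi / 2 - θ)|)⁻¹ := by positivity
    filter_upwards [Ioo_mem_nhdsGT hpos] with ρ hρ
    rw [← setIntegral_planeWeight hij hr σ _ hρ.1 hρ.2]
    refine (setIntegral_planeRefl hij θ ρ _ _).trans ?_
    simp only [weight_planeRefl hn hθ]
  rw [YoungPV, tendsto_congr' hev, tendsto_const_nhds_iff]
  simp

end Young

section Balance

variable {τ : ℝ → ℝ}

lemma pos_of_strictMono_of_tendsto (hmono : StrictMono τ) (hlim : Tendsto τ atBot (𝓝 0))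
    (c : ℝ) : 0 < τ c :=
  (hmono.monotone.le_of_tendsto hlim (c - 1)).trans_lt (hmono (sub_one_lt c))

lemma strictMono_balance (hmono : StrictMono τ) {σ : ℝ} (hσ : σ ∈ Set.Ioo (-1 : ℝ) 1) :
    StrictMono fun c => (1 + σ) * τ c - (1 - σ) * τ (-c) := fun a b hab => by
  have h1 := mul_lt_mul_of_pos_left (hmono hab) (by linarith [hσ.1] : 0 < 1 + σ)
  have h2 := mul_lt_mul_of_pos_left (hmono (neg_lt_neg hab)) (by linarith [hσ.2] : 0 < 1 - σ)
  simp only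
  linarith

lemma exists_balance_eq_zero (hmono : StrictMono τ) (hcont : Continuous τ)
    (hlim : Tendsto τ atBot (𝓝 0)) {σ : ℝ} (hσ : σ ∈ Set.Ioo (-1 : ℝ) 1) :
    ∃ c, (1 + σ) * τ c - (1 - σ) * τ (-c) = 0 := by
  have hpos := pos_of_strictMono_of_tendsto hmono hlim
  have hex : ∀ {a b : ℝ}, 0 < a → 0 < b → ∃ c < 0, a * τ c < b * τ (-c) := by
    intro a b ha hb
    have h : Tendsto (fun c => a * τ c) atBot (𝓝 0) := by simpa using hlim.const_mul a
    obtain ⟨c, hc, hc0⟩ := ((h.eventually_lt_const (mul_pos hb (hpos 0))).and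
      (eventually_lt_atBot 0)).exists
    exact ⟨c, hc0, hc.trans (mul_lt_mul_of_pos_left (hmono (neg_pos.2 hc0)) hb)⟩
  obtain ⟨a, ha0, ha⟩ := hex (by linarith [hσ.1] : 0 < 1 + σ) (by linarith [hσ.2] : 0 < 1 - σ)
  obtain ⟨b, hb0, hb⟩ := hex (by linarith [hσ.2] : 0 < 1 - σ) (by linarith [hσ.1] : 0 < 1 + σ)
  have hf : Continuous fun c => (1 + σ) * τ c - (1 - σ) * τ (-c) := by fun_prop
  refine mem_range_of_exists_le_of_exists_ge hf ⟨a, by linarith⟩ ⟨-b, ?_⟩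
  rw [neg_neg]
  linarith

variable {γ : ℝ → ℝ}

lemma strictAntiOn_of_balance (hmono : StrictMono τ) (hpos : ∀ c, 0 < τ c)
    (hγ : ∀ σ ∈ Set.Ioo (-1 : ℝ) 1, (1 + σ) * τ (γ σ) - (1 - σ) * τ (-γ σ) = 0) :
    StrictAntiOn γ (Set.Ioo (-1) 1) := by
  intro σ hσ σ' hσ' hlt
  refine (strictMono_balance hmono hσ').lt_iff_lt.1 ?_
  simp only [hγ σ' hσ']
  nlinarith [hγ σ hσ, mul_pos (sub_pos.2 hlt) (add_pos (hpos (γ σ)) (hpos (-γ σ)))]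

lemma tendsto_atTop_of_balance (hmono : StrictMono τ) (hpos : ∀ c, 0 < τ c)
    (hγ : ∀ σ ∈ Set.Ioo (-1 : ℝ) 1, (1 + σ) * τ (γ σ) - (1 - σ) * τ (-γ σ) = 0) :
    Tendsto γ (𝓝[>] (-1)) atTop := by
  refine tendsto_atTop.2 fun c => ?_
  have hcont : ContinuousAt (fun σ : ℝ => (1 + σ) * τ c - (1 - σ) * τ (-c)) (-1) := by fun_prop
  have hev := hcont.eventually_lt_const (u := 0) (by linarith [hpos (-c)])
  filter_upwards [hev.filter_mono nhdsWithin_le_nhds,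
    Ioo_mem_nhdsGT (by norm_num : (-1 : ℝ) < 1)] with σ h hσ
  refine ((strictMono_balance hmono hσ).lt_iff_lt.1 ?_).le
  simpa only [hγ σ hσ] using h

lemma tendsto_atBot_of_balance (hmono : StrictMono τ) (hpos : ∀ c, 0 < τ c)
    (hγ : ∀ σ ∈ Set.Ioo (-1 : ℝ) 1, (1 + σ) * τ (γ σ) - (1 - σ) * τ (-γ σ) = 0) :
    Tendsto γ (𝓝[<] 1) atBot := by
  refine tendsto_atBot.2 fun c => ?_
  have hcont : ContinuousAt (fun σ : ℝ => (1 + σ) * τ c - (1 - σ) * τ (-c)) 1 := by fun_prop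
  have hev := hcont.eventually_const_lt (u := 0) (by linarith [hpos c])
  filter_upwards [hev.filter_mono nhdsWithin_le_nhds,
    Ioo_mem_nhdsLT (by norm_num : (-1 : ℝ) < 1)] with σ h hσ
  refine ((strictMono_balance hmono hσ).lt_iff_lt.1 ?_).le
  simpa only [hγ σ hσ] using h

end Balance

end YoungLaw

/-- Existence, uniqueness and monotonicity of the contact angle of the
nonlocal Young's law. -/
theorem stmt5 (n : ℕ) (hn : 2 ≤ n) (s : ℝ) (hs : s ∈ Set.Ioo (0 : ℝ) 1) :
    (∀ σ ∈ Set.Ioo (-1 : ℝ) 1,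
      ∃! θ : ℝ, θ ∈ Set.Ioo 0 Real.pi ∧ YoungPV n hn s σ θ) ∧
    (∀ θf : ℝ → ℝ,
      (∀ σ ∈ Set.Ioo (-1 : ℝ) 1, θf σ ∈ Set.Ioo 0 Real.pi ∧ YoungPV n hn s σ (θf σ)) →
      StrictMonoOn θf (Set.Ioo (-1 : ℝ) 1) ∧
      θf 0 = Real.pi / 2 ∧
      Tendsto θf (𝓝[>] (-1 : ℝ)) (nhds 0) ∧
      Tendsto θf (𝓝[<] (1 : ℝ)) (nhds Real.pi)) := by
  have hij : (⟨0, by omega⟩ : Fin n) ≠ ⟨n - 1, by omega⟩ := by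
    simp only [ne_eq, Fin.mk.injEq]; omega
  have hr : (Fintype.card (Fin n) : ℝ) < n + s := by simpa using hs.1
  have hY := fun (σ θ : ℝ) (hθ : θ ∈ Set.Ioo 0 Real.pi) => YoungLaw.youngPV_iff hn hθ hs.1 σ
  have hmono := YoungLaw.strictMono_coneMass hij hr
  have hcont := YoungLaw.continuous_coneMass hij hr
  have hlim := YoungLaw.tendsto_coneMass_atBot hij hr
  set τ := YoungLaw.coneMass (⟨0, by omega⟩ : Fin n) ⟨n - 1, by omega⟩ (n + s)
  have hpos := YoungLaw.pos_of_strictMono_of_tendsto hmono hlim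
  have harctan : ∀ θ ∈ Set.Ioo 0 Real.pi,
      θ = Real.pi / 2 - Real.arctan (Real.tan (Real.pi / 2 - θ)) := fun θ hθ => by
    rw [Real.arctan_tan (by linarith [hθ.2]) (by linarith [hθ.1]), sub_sub_cancel]
  refine ⟨fun σ hσ => ?_, fun θf hθf => ?_⟩
  · obtain ⟨c, hc⟩ := YoungLaw.exists_balance_eq_zero hmono hcont hlim hσ
    have hmem : Real.pi / 2 - Real.arctan c ∈ Set.Ioo 0 Real.pi :=
      ⟨by linarith [Real.arctan_lt_pi_div_two c], by linarith [Real.neg_pi_div_two_lt_arctan c]⟩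
    refine ⟨Real.pi / 2 - Real.arctan c, ⟨hmem, ?_⟩, ?_⟩
    · rwa [hY σ _ hmem, sub_sub_cancel, Real.tan_arctan]
    · rintro θ ⟨hθ, hPV⟩
      rw [hY σ θ hθ] at hPV
      rw [harctan θ hθ, (YoungLaw.strictMono_balance hmono hσ).injective (hPV.trans hc.symm)]
  · set γ : ℝ → ℝ := fun σ => Real.tan (Real.pi / 2 - θf σ)
    have hγ : ∀ σ ∈ Set.Ioo (-1 : ℝ) 1, (1 + σ) * τ (γ σ) - (1 - σ) * τ (-γ σ) = 0 :=
      fun σ hσ => (hY σ _ (hθf σ hσ).1).1 (hθf σ hσ).2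
    have hθ : ∀ σ ∈ Set.Ioo (-1 : ℝ) 1, θf σ = Real.pi / 2 - Real.arctan (γ σ) :=
      fun σ hσ => harctan _ (hθf σ hσ).1
    refine ⟨fun σ hσ σ' hσ' hlt => ?_, ?_, ?_, ?_⟩
    · rw [hθ σ hσ, hθ σ' hσ']
      exact sub_lt_sub_left (Real.arctan_strictMono
        (YoungLaw.strictAntiOn_of_balance hmono hpos hγ hσ hσ' hlt)) _
    · have h0 : (0 : ℝ) ∈ Set.Ioo (-1 : ℝ) 1 := by norm_num
      have hγ0 : γ 0 = 0 :=
        (YoungLaw.strictMono_balance hmono h0).injective ((hγ 0 h0).trans (by simp))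
      rw [hθ 0 h0, hγ0, Real.arctan_zero, sub_zero]
    · have h := ((Real.tendsto_arctan_atTop.mono_right nhdsWithin_le_nhds).comp
        (YoungLaw.tendsto_atTop_of_balance hmono hpos hγ)).const_sub (Real.pi / 2)
      rw [sub_self] at h
      refine h.congr' ?_
      filter_upwards [Ioo_mem_nhdsGT (by norm_num : (-1 : ℝ) < 1)] with σ hσ
      exact (hθ σ hσ).symm
    · have h := ((Real.tendsto_arctan_atBot.mono_right nhdsWithin_le_nhds).comp
        (YoungLaw.tendsto_atBot_of_balance hmono hpos hγ)).const_sub (Real.pi / 2)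
      rw [sub_neg_eq_add, add_halves] at h
      refine h.congr' ?_
      filter_upwards [Ioo_mem_nhdsLT (by norm_num : (-1 : ℝ) < 1)] with σ hσ
      exact (hθ σ hσ).symm
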